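/- For every n ≥ 2 there exists a linear map φ: ℓ_∞^n → M_n(ℂ) such that ‖φ‖ ≤ √2 and ‖φ‖_{cb} ≥ √(log₂ n). -/

import Mathlib

open scoped Matrix BigOperators

noncomputable def opNorm {ι : Type*} [Fintype ι] [DecidableEq ι] (A : Matrix ι ι ℂ) : ℝ :=
  ‖Matrix.toEuclideanCLM (𝕜 := ℂ) A‖

/-- The completely bounded norm of a linear map `φ : ℓ_∞^n → M_d(ℂ)`:
the supremum over `k` of the norms of the amplifications
`id_{M_k} ⊗ φ : M_k(ℓ_∞^n) → M_k(M_d)`, where a matrix `B ∈ M_k(ℓ_∞^n)` has norm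
`sup_i ‖(B_{rs}(i))_{rs}‖`. -/
noncomputable def cbNorm {n : ℕ} {ι : Type*} [Fintype ι] [DecidableEq ι]
    (φ : (Fin n → ℂ) →ₗ[ℂ] Matrix ι ι ℂ) : ℝ :=
  ⨆ k : ℕ, sSup {r : ℝ | ∃ B : Matrix (Fin k) (Fin k) (Fin n → ℂ),
    (∀ i : Fin n, opNorm (Matrix.of fun p q => B p q i) ≤ 1) ∧
    r = opNorm (Matrix.of fun p q : Fin k × ι => φ (B p.1 q.1) p.2 q.2)}

open scoped Matrix.Norms.L2Operator Kronecker

theorem aux_gens (m : ℕ) : ∃ (I : Type) (_ : Fintype I) (_ : DecidableEq I)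
    (u : Fin (m+1) → Matrix I I ℂ), Fintype.card I = 2 ^ m ∧ (∀ i, (u i)ᴴ = u i) ∧
    (∀ i, (u i)ᵀ = u i) ∧ (∀ i, u i * u i = 1) ∧ (∀ i j, i ≠ j → u i * u j = - (u j * u i)) := by
  induction m with
  | zero =>
    refine ⟨Unit, inferInstance, inferInstance, fun _ => 1, by simp, by simp, by simp, by simp, ?_⟩
    intro i j h
    exact absurd (Subsingleton.elim (α := Fin 1) i j) h
  | succ m ih =>
    obtain ⟨I, _, _, u, hc, h1, h2, h3, h4⟩ := ih
    have hX : (!![0,1;1,0] : Matrix (Fin 2) (Fin 2) ℂ) * !![0,1;1,0] = 1 := by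
      ext i j; fin_cases i <;> fin_cases j <;> simp
    have hZ : (!![1,0;0,-1] : Matrix (Fin 2) (Fin 2) ℂ) * !![1,0;0,-1] = 1 := by
      ext i j; fin_cases i <;> fin_cases j <;> simp
    have hXZ : (!![0,1;1,0] : Matrix (Fin 2) (Fin 2) ℂ) * !![1,0;0,-1]
        = - (!![1,0;0,-1] * !![0,1;1,0]) := by
      ext i j; fin_cases i <;> fin_cases j <;> simp
    have hXh : (!![0,1;1,0] : Matrix (Fin 2) (Fin 2) ℂ)ᴴ = !![0,1;1,0] := by
      ext i j; fin_cases i <;> fin_cases j <;> simp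
    have hZh : (!![1,0;0,-1] : Matrix (Fin 2) (Fin 2) ℂ)ᴴ = !![1,0;0,-1] := by
      ext i j; fin_cases i <;> fin_cases j <;> simp
    have hXt : (!![0,1;1,0] : Matrix (Fin 2) (Fin 2) ℂ)ᵀ = !![0,1;1,0] := by
      ext i j; fin_cases i <;> fin_cases j <;> simp
    have hZt : (!![1,0;0,-1] : Matrix (Fin 2) (Fin 2) ℂ)ᵀ = !![1,0;0,-1] := by
      ext i j; fin_cases i <;> fin_cases j <;> simp
    generalize (!![0,1;1,0] : Matrix (Fin 2) (Fin 2) ℂ) = X at *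
    generalize (!![1,0;0,-1] : Matrix (Fin 2) (Fin 2) ℂ) = Z at *
    have kneg : ∀ (A : Matrix I I ℂ) (B : Matrix (Fin 2) (Fin 2) ℂ), A ⊗ₖ (-B) = -(A ⊗ₖ B) := by
      intro A B; ext; simp [Matrix.kroneckerMap_apply]
    have kneg' : ∀ (A : Matrix I I ℂ) (B : Matrix (Fin 2) (Fin 2) ℂ), (-A) ⊗ₖ B = -(A ⊗ₖ B) := by
      intro A B; ext; simp [Matrix.kroneckerMap_apply]
    refine ⟨I × Fin 2, inferInstance, inferInstance,
      Fin.cons ((1 : Matrix I I ℂ) ⊗ₖ X) (fun i => u i ⊗ₖ Z), ?_, ?_, ?_, ?_, ?_⟩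
    · simp [hc, pow_succ]
    · intro i
      refine Fin.cases ?_ (fun i => ?_) i
      · simp [Matrix.conjTranspose_kronecker, hXh]
      · simp [Matrix.conjTranspose_kronecker, hZh, h1]
    · intro i
      refine Fin.cases ?_ (fun i => ?_) i
      · simp [← Matrix.kroneckerMap_transpose, hXt]
      · simp [← Matrix.kroneckerMap_transpose, hZt, h2]
    · intro i
      refine Fin.cases ?_ (fun i => ?_) i
      · simp [← Matrix.mul_kronecker_mul, hX]
      · simp [← Matrix.mul_kronecker_mul, hZ, h3]
    · intro i j
      refine Fin.cases ?_ (fun i => ?_) i <;> refine Fin.cases ?_ (fun j => ?_) j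
      · simp
      · intro _
        simp only [Fin.cons_zero, Fin.cons_succ, ← Matrix.mul_kronecker_mul]
        rw [hXZ, kneg]; simp
      · intro _
        simp only [Fin.cons_zero, Fin.cons_succ, ← Matrix.mul_kronecker_mul]
        rw [hXZ, kneg]; simp
      · intro h
        have : i ≠ j := fun e => h (by rw [e])
        simp only [Fin.cons_succ, ← Matrix.mul_kronecker_mul]
        rw [h4 i j this, kneg']

theorem aux_corner (m n : ℕ) (h : 2 ^ m ≤ n) : ∃ (P : Matrix (Fin n) (Fin n) ℂ)
    (w : Fin (m+1) → Matrix (Fin n) (Fin n) ℂ), P ≠ 0 ∧ Pᴴ = P ∧ P * P = P ∧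
    (∀ i, (w i)ᴴ = w i) ∧ (∀ i, (w i)ᵀ = w i) ∧ (∀ i, w i * P = w i) ∧
    (∀ i j, w i * w j + w j * w i = if i = j then (2:ℂ) • P else 0) := by
  obtain ⟨I, _, _, u, hc, h1, h2, h3, h4⟩ := aux_gens m
  have : Nonempty (I ↪ Fin n) := by
    apply Function.Embedding.nonempty_of_card_le; simp [hc, h]
  obtain ⟨e⟩ := this
  have hne : Nonempty I := by
    rw [← Fintype.card_pos_iff, hc]; positivity
  let V : Matrix (Fin n) I ℂ := Matrix.of fun i j => if i = e j then 1 else 0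
  have hV : Vᵀ * V = 1 := by
    ext i j
    simp [V, Matrix.mul_apply, Matrix.one_apply, eq_comm]
  have hVh : Vᴴ = Vᵀ := by
    ext i j; simp only [V, Matrix.conjTranspose_apply, Matrix.transpose_apply, Matrix.of_apply]
    split_ifs <;> simp
  have hVth : (Vᵀ)ᴴ = V := by rw [← hVh, Matrix.conjTranspose_conjTranspose]
  have key : ∀ A B : Matrix I I ℂ, (V * A * Vᵀ) * (V * B * Vᵀ) = V * (A * B) * Vᵀ := by
    intro A B
    calc _ = V * A * (Vᵀ * V) * B * Vᵀ := by simp only [Matrix.mul_assoc]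
      _ = _ := by rw [hV]; simp only [Matrix.mul_assoc, Matrix.mul_one]
  refine ⟨V * (1 : Matrix I I ℂ) * Vᵀ, fun i => V * u i * Vᵀ, ?_, ?_, ?_, ?_, ?_, ?_, ?_⟩
  · intro h0
    have h5 : Vᵀ * (V * (1 : Matrix I I ℂ) * Vᵀ) * V = 1 := by
      calc _ = (Vᵀ * V) * (Vᵀ * V) := by simp only [Matrix.mul_assoc, Matrix.mul_one]
        _ = 1 := by simp [hV]
    rw [h0] at h5
    simp at h5
  · simp [Matrix.conjTranspose_mul, hVh, hVth]
  · rw [key]; simp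
  · intro i; simp [Matrix.conjTranspose_mul, hVh, hVth, h1, Matrix.mul_assoc]
  · intro i; simp [Matrix.transpose_mul, h2, Matrix.mul_assoc]
  · intro i; simp only [key, mul_one]
  · intro i j
    simp only [key]
    split_ifs with hij
    · subst hij; rw [h3, two_smul]
    · rw [h4 i j hij]; simp

theorem opNorm_eq {ι : Type*} [Fintype ι] [DecidableEq ι] (A : Matrix ι ι ℂ) :
    opNorm A = ‖A‖ := rfl

theorem norm_le_one_of_proj {n : ℕ} (P : Matrix (Fin n) (Fin n) ℂ) (h1 : Pᴴ = P)
    (h2 : P * P = P) : ‖P‖ ≤ 1 := by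
  have := Matrix.l2_opNorm_conjTranspose_mul_self P
  rw [h1, h2] at this
  nlinarith [norm_nonneg P]

theorem real_comb {n N : ℕ} (P : Matrix (Fin n) (Fin n) ℂ)
    (w : Fin N → Matrix (Fin n) (Fin n) ℂ) (hP : ‖P‖ ≤ 1) (hw : ∀ i, (w i)ᴴ = w i)
    (hc : ∀ i j, w i * w j + w j * w i = if i = j then (2:ℂ) • P else 0) (x : Fin N → ℝ) :
    ‖∑ i, (x i : ℂ) • w i‖ ≤ √(∑ i, x i ^ 2) := by
  set X := ∑ i, (x i : ℂ) • w i with hX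
  have hXh : Xᴴ = X := by
    simp [hX, Matrix.conjTranspose_sum, Matrix.conjTranspose_smul, hw]
  have hXX : X * X = ((∑ i, x i ^ 2 : ℝ) : ℂ) • P := by
    have e1 : X * X = ∑ i, ∑ j, ((x i : ℂ) * x j) • (w i * w j) := by
      rw [hX, Finset.sum_mul_sum]
      refine Finset.sum_congr rfl fun i _ => Finset.sum_congr rfl fun j _ => ?_
      rw [smul_mul_smul_comm]
    have e2 : X * X = ∑ i, ∑ j, ((x i : ℂ) * x j) • (w j * w i) := by
      rw [e1, Finset.sum_comm]
      simp [mul_comm]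
    have e3 : (2:ℂ) • (X * X) = (2:ℂ) • (((∑ i, x i ^ 2 : ℝ) : ℂ) • P) := by
      rw [two_smul]
      nth_rewrite 1 [e1]
      rw [e2, ← Finset.sum_add_distrib]
      simp_rw [← Finset.sum_add_distrib, ← smul_add, hc]
      simp [Finset.sum_smul, Finset.smul_sum, smul_smul]
      refine Finset.sum_congr rfl fun i _ => ?_
      congr 1; ring
    exact smul_right_injective _ (two_ne_zero) e3
  have h5 := Matrix.l2_opNorm_conjTranspose_mul_self X
  rw [hXh, hXX, norm_smul] at h5
  have h0 : 0 ≤ ∑ i, x i ^ 2 := Finset.sum_nonneg fun i _ => sq_nonneg _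
  rw [Complex.norm_real, Real.norm_of_nonneg h0] at h5
  apply Real.le_sqrt_of_sq_le
  nlinarith

theorem cplx_comb {n N : ℕ} (P : Matrix (Fin n) (Fin n) ℂ)
    (w : Fin N → Matrix (Fin n) (Fin n) ℂ) (hP : ‖P‖ ≤ 1) (hw : ∀ i, (w i)ᴴ = w i)
    (hc : ∀ i j, w i * w j + w j * w i = if i = j then (2:ℂ) • P else 0) (a : Fin N → ℂ)
    (ha : ∀ i, ‖a i‖ ≤ 1) :
    ‖∑ i, a i • w i‖ ≤ √2 * √N := by
  have h1 := real_comb P w hP hw hc (fun i => (a i).re)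
  have h2 := real_comb P w hP hw hc (fun i => (a i).im)
  have h3 : ∑ i, a i • w i = ∑ i, ((a i).re : ℂ) • w i
      + Complex.I • ∑ i, ((a i).im : ℂ) • w i := by
    rw [Finset.smul_sum, ← Finset.sum_add_distrib]
    refine Finset.sum_congr rfl fun i _ => ?_
    rw [smul_smul, ← add_smul, mul_comm Complex.I, Complex.re_add_im]
  have h4 : ∑ i, (a i).re ^ 2 + ∑ i, (a i).im ^ 2 ≤ N := by
    rw [← Finset.sum_add_distrib]
    calc _ ≤ ∑ i : Fin N, (1:ℝ) := by
          refine Finset.sum_le_sum fun i _ => ?_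
          have := Complex.sq_norm (a i)
          rw [Complex.normSq_apply] at this
          nlinarith [ha i, norm_nonneg (a i)]
      _ = N := by simp
  have hs : 0 ≤ ∑ i, (a i).re ^ 2 := Finset.sum_nonneg fun i _ => sq_nonneg _
  have ht : 0 ≤ ∑ i, (a i).im ^ 2 := Finset.sum_nonneg fun i _ => sq_nonneg _
  rw [h3]
  refine (norm_add_le _ _).trans ?_
  rw [norm_smul, Complex.norm_I, one_mul]
  refine (add_le_add h1 h2).trans ?_
  rw [← Real.sqrt_mul (by norm_num)]
  apply Real.le_sqrt_of_sq_le
  nlinarith [Real.sq_sqrt hs, Real.sq_sqrt ht,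
    sq_nonneg (√(∑ i, (a i).re ^ 2) - √(∑ i, (a i).im ^ 2))]

theorem norm_kron_one {k n : ℕ} (A : Matrix (Fin k) (Fin k) ℂ) :
    ‖A ⊗ₖ (1 : Matrix (Fin n) (Fin n) ℂ)‖ ≤ ‖A‖ := by
  let f : Matrix (Fin k) (Fin k) ℂ →⋆ₙₐ[ℂ] Matrix (Fin k × Fin n) (Fin k × Fin n) ℂ :=
    { toFun := fun A => A ⊗ₖ 1
      map_smul' := fun c A => by simp [Matrix.smul_kronecker]
      map_zero' := by simp
      map_add' := fun A B => by simp [Matrix.add_kronecker]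
      map_mul' := fun A B => by simp [← Matrix.mul_kronecker_mul]
      map_star' := fun A => by
        simp [Matrix.star_eq_conjTranspose, Matrix.conjTranspose_kronecker] }
  exact NonUnitalStarAlgHom.norm_apply_le f A

theorem norm_one_kron {k n : ℕ} (A : Matrix (Fin n) (Fin n) ℂ) :
    ‖(1 : Matrix (Fin k) (Fin k) ℂ) ⊗ₖ A‖ ≤ ‖A‖ := by
  let f : Matrix (Fin n) (Fin n) ℂ →⋆ₙₐ[ℂ] Matrix (Fin k × Fin n) (Fin k × Fin n) ℂ :=
    { toFun := fun A => 1 ⊗ₖ A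
      map_smul' := fun c A => by simp [Matrix.kronecker_smul]
      map_zero' := by simp
      map_add' := fun A B => by simp [Matrix.kronecker_add]
      map_mul' := fun A B => by simp [← Matrix.mul_kronecker_mul]
      map_star' := fun A => by
        simp [Matrix.star_eq_conjTranspose, Matrix.conjTranspose_kronecker] }
  exact NonUnitalStarAlgHom.norm_apply_le f A

theorem norm_kron {k n : ℕ} (A : Matrix (Fin k) (Fin k) ℂ) (B : Matrix (Fin n) (Fin n) ℂ) :
    ‖A ⊗ₖ B‖ ≤ ‖A‖ * ‖B‖ := by
  have : A ⊗ₖ B = (A ⊗ₖ 1) * (1 ⊗ₖ B) := by simp [← Matrix.mul_kronecker_mul]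
  rw [this]
  exact (norm_mul_le _ _).trans
    (mul_le_mul (norm_kron_one A) (norm_one_kron B) (norm_nonneg _) (norm_nonneg _))

theorem cb_bound {n k : ℕ} (φ : (Fin n → ℂ) →ₗ[ℂ] Matrix (Fin n) (Fin n) ℂ)
    (B : Matrix (Fin k) (Fin k) (Fin n → ℂ))
    (hB : ∀ i : Fin n, opNorm (Matrix.of fun p q => B p q i) ≤ 1) :
    opNorm (Matrix.of fun p q : Fin k × Fin n => φ (B p.1 q.1) p.2 q.2) ≤
      ∑ j, ‖φ (Pi.single j 1)‖ := by
  have : (Matrix.of fun p q : Fin k × Fin n => φ (B p.1 q.1) p.2 q.2)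
      = ∑ j, (Matrix.of fun p q => B p q j) ⊗ₖ φ (Pi.single j 1) := by
    ext p q
    have h : B p.1 q.1 = ∑ j, B p.1 q.1 j • (Pi.single j 1 : Fin n → ℂ) := by
      ext l; simp [Finset.sum_apply, Pi.single_apply]
    rw [Matrix.of_apply]
    conv_lhs => rw [h]
    simp [map_sum, Matrix.sum_apply, Matrix.kroneckerMap_apply]
  rw [this, opNorm_eq]
  refine (norm_sum_le _ _).trans (Finset.sum_le_sum fun j _ => ?_)
  refine (norm_kron _ _).trans ?_
  have := hB j
  rw [opNorm_eq] at this
  exact mul_le_of_le_one_left (norm_nonneg _) this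

theorem le_cbNorm {n k : ℕ} (φ : (Fin n → ℂ) →ₗ[ℂ] Matrix (Fin n) (Fin n) ℂ)
    (B : Matrix (Fin k) (Fin k) (Fin n → ℂ))
    (hB : ∀ i : Fin n, opNorm (Matrix.of fun p q => B p q i) ≤ 1) :
    opNorm (Matrix.of fun p q : Fin k × Fin n => φ (B p.1 q.1) p.2 q.2) ≤ cbNorm φ := by
  unfold cbNorm
  have hC : 0 ≤ ∑ j, ‖φ (Pi.single j 1)‖ := Finset.sum_nonneg fun _ _ => norm_nonneg _
  refine le_trans ?_ (le_ciSup (ι := ℕ) ?_ k)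
  · refine le_csSup ⟨∑ j, ‖φ (Pi.single j 1)‖, ?_⟩ ⟨B, hB, rfl⟩
    rintro r ⟨B', hB', rfl⟩
    exact cb_bound φ B' hB'
  · refine ⟨∑ j, ‖φ (Pi.single j 1)‖, ?_⟩
    rintro _ ⟨l, rfl⟩
    refine Real.sSup_le ?_ hC
    rintro r ⟨B', hB', rfl⟩
    exact cb_bound φ B' hB'

theorem le_norm_of_eig {ι : Type*} [Fintype ι] [DecidableEq ι] (M : Matrix ι ι ℂ)
    (v : ι → ℂ) (hv : v ≠ 0) (c : ℝ) (h : M *ᵥ v = (c : ℂ) • v) : c ≤ ‖M‖ := by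
  have h1 := Matrix.l2_opNorm_mulVec M (WithLp.toLp 2 v)
  have hpos : 0 < ‖WithLp.toLp 2 v‖ := by
    rw [norm_pos_iff]; simpa using hv
  simp only [WithLp.ofLp_toLp, h] at h1
  rw [show (EuclideanSpace.equiv ι ℂ).symm ((c:ℂ) • v) = (c:ℂ) • WithLp.toLp 2 v from rfl,
    norm_smul, Complex.norm_real] at h1
  exact (le_abs_self c).trans (le_of_mul_le_mul_right h1 hpos)

/-- For every `n ≥ 2` there exists a linear map `φ : ℓ_∞^n → M_n(ℂ)` with
`‖φ‖ ≤ √2` (i.e. `‖φ(a)‖ ≤ √2` whenever `sup_i |a i| ≤ 1`) and `‖φ‖_cb ≥ √(log₂ n)`. -/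
theorem stmt5 (n : ℕ) (hn : 2 ≤ n) :
    ∃ φ : (Fin n → ℂ) →ₗ[ℂ] Matrix (Fin n) (Fin n) ℂ,
      (∀ a : Fin n → ℂ, (∀ i, ‖a i‖ ≤ 1) → opNorm (φ a) ≤ Real.sqrt 2) ∧
      Real.sqrt (Real.logb 2 n) ≤ cbNorm φ := by
  set m := Nat.log 2 n with hm
  have hmn : 2 ^ m ≤ n := Nat.pow_log_le_self 2 (by omega)
  have hN : m + 1 ≤ n := (Nat.lt_two_pow_self (n := m)).trans_le hmn
  obtain ⟨P, w, hP0, hPh, hPP, hwh, hwt, hwP, hc⟩ := aux_corner m n hmn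
  have hP := norm_le_one_of_proj P hPh hPP
  have hww : ∀ i, w i * w i = P := by
    intro i
    have := hc i i
    rw [if_pos rfl, ← two_smul ℂ (w i * w i)] at this
    exact smul_right_injective _ (two_ne_zero) this
  have hw1 : ∀ i, ‖w i‖ ≤ 1 := by
    intro i
    have := Matrix.l2_opNorm_conjTranspose_mul_self (w i)
    rw [hwh, hww] at this
    nlinarith [norm_nonneg (w i)]
  have hNpos : (0:ℝ) < √((m + 1 : ℕ) : ℝ) := by
    apply Real.sqrt_pos.2; positivity
  set s : ℝ := √((m + 1 : ℕ) : ℝ) with hs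
  have hss : s * s = ((m + 1 : ℕ) : ℝ) := Real.mul_self_sqrt (by positivity)
  let φ : (Fin n → ℂ) →ₗ[ℂ] Matrix (Fin n) (Fin n) ℂ :=
    { toFun := fun a => ((s⁻¹ : ℝ) : ℂ) • ∑ i, a (Fin.castLE hN i) • w i
      map_add' := fun a b => by simp [add_smul, Finset.sum_add_distrib]
      map_smul' := fun c a => by
        simp only [Pi.smul_apply, smul_eq_mul, RingHom.id_apply, Finset.smul_sum, smul_smul]
        refine Finset.sum_congr rfl fun i _ => ?_
        congr 1; ring }
  have hφ : ∀ a, φ a = ((s⁻¹ : ℝ) : ℂ) • ∑ i, a (Fin.castLE hN i) • w i := fun _ => rfl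
  refine ⟨φ, ?_, ?_⟩
  · intro a ha
    rw [opNorm_eq, hφ, norm_smul, Complex.norm_real, Real.norm_of_nonneg (by positivity)]
    have := cplx_comb P w hP hwh hc (fun i => a (Fin.castLE hN i)) (fun i => ha _)
    rw [← hs] at this
    rw [inv_mul_le_iff₀ hNpos, mul_comm]
    exact this
  · let B : Matrix (Fin n) (Fin n) (Fin n → ℂ) := Matrix.of fun p q j =>
      if h : (j : ℕ) < m + 1 then w ⟨j, h⟩ p q else 0
    have hB : ∀ i : Fin n, opNorm (Matrix.of fun p q => B p q i) ≤ 1 := by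
      intro j
      rw [opNorm_eq]
      by_cases h : (j : ℕ) < m + 1
      · convert hw1 ⟨j, h⟩ using 2
        ext p q; simp only [B, Matrix.of_apply, dif_pos h]
      · have : (Matrix.of fun p q => B p q j) = 0 := by
          ext p q; simp only [B, Matrix.of_apply, dif_neg h, Matrix.zero_apply]
        rw [this]; simp
    refine le_trans ?_ (le_cbNorm φ B hB)
    have hlog : √(Real.logb 2 n) ≤ s := by
      apply Real.sqrt_le_sqrt
      have h1 : (n:ℝ) < (2:ℝ) ^ (m+1) := by
        exact_mod_cast Nat.lt_pow_succ_log_self (b := 2) (by norm_num) n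
      rw [Real.logb_le_iff_le_rpow (by norm_num) (by positivity), Real.rpow_natCast]
      exact h1.le
    refine hlog.trans ?_
    rw [opNorm_eq]
    refine le_norm_of_eig _ (fun p => P p.1 p.2) ?_ s ?_
    · intro h0
      apply hP0
      ext i j
      exact congrFun h0 (i, j)
    · have hone : ∀ i, w i * P * (w i)ᵀ = P := by
        intro i; rw [hwP, hwt, hww]
      ext ⟨p, r⟩
      have hBφ : ∀ q t, φ (B p q) r t = ((s⁻¹ : ℝ) : ℂ) * ∑ i, w i p q * w i r t := by
        intro q t
        rw [hφ]
        have hb : ∀ i, B p q (Fin.castLE hN i) = w i p q := by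
          intro i
          have hi : ((Fin.castLE hN i : Fin n) : ℕ) < m + 1 := i.is_lt
          simp only [B, Matrix.of_apply, dif_pos hi]
          rfl
        simp only [hb, Matrix.smul_apply, Matrix.sum_apply, smul_eq_mul]
      simp only [Matrix.mulVec, dotProduct, Matrix.of_apply, hBφ, Pi.smul_apply, smul_eq_mul,
        Fintype.sum_prod_type]
      have h2 : ∀ i, ∑ q, ∑ t, w i p q * w i r t * P q t = P p r := by
        intro i
        conv_rhs => rw [← hone i]
        simp only [Matrix.mul_apply, Matrix.transpose_apply, Finset.sum_mul]
        rw [Finset.sum_comm]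
        refine Finset.sum_congr rfl fun _ _ => Finset.sum_congr rfl fun _ _ => ?_
        ring
      calc _ = ((s⁻¹ : ℝ) : ℂ) * ∑ i, ∑ q, ∑ t, w i p q * w i r t * P q t := by
            simp only [Finset.mul_sum, Finset.sum_mul]
            symm
            rw [Finset.sum_comm]
            refine Finset.sum_congr rfl fun _ _ => ?_
            rw [Finset.sum_comm]
            refine Finset.sum_congr rfl fun _ _ => Finset.sum_congr rfl fun _ _ => ?_
            ring
        _ = (s : ℂ) * P p r := by
            simp only [h2, Finset.sum_const, Finset.card_univ, Fintype.card_fin, nsmul_eq_mul]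
            rw [← mul_assoc]
            congr 1
            have : s⁻¹ * ((m + 1 : ℕ) : ℝ) = s := by
              rw [← hss]; field_simp
            exact_mod_cast this
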